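/- arXiv:2201.03711 — 3 statements merged into one kernel-verified Lean document; each statement's English description precedes it below -/
import Mathlib

section
/- Let n ≥ 1, let k_b ∈ ℝⁿ have all entries positive, and let K₁, K₂ be positive definite real n×n matrices. Let z₁, z₂ : ℝ → ℝⁿ be differentiable functions such that for all t ≥ 0: ż₁(t) = z₂(t) − D₁(t)⁻¹ K₁ z₁(t) and ż₂(t) = −K₂ z₂(t) − D₁(t) z₁(t), where D₁(t) is the diagonal matrix with i-th diagonal entry 1/(k_{b,i}² − z₁ᵢ(t)²). If |z₁ᵢ(0)| < k_{b,i} for every i = 1,…,n, then |z₁ᵢ(t)| < k_{b,i} for every i and all t ≥ 0. -/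
open Filter Topology in
/-- A continuous trajectory starting in the open box with half-widths `kb` stays in it, provided that
as long as it has not left the box, its distance to the faces is uniformly bounded below. -/
theorem forall_abs_lt_of_barrier {ι : Type*} [Finite ι] (kb : ι → ℝ)
    (hkb : ∀ i, 0 < kb i) (z : ℝ → ι → ℝ) (hz : Continuous z) (h0 : ∀ i, |z 0 i| < kb i)
    (c : ι → ℝ) (hc : ∀ i, 0 < c i)
    (hbar : ∀ s, 0 ≤ s → (∀ u ∈ Set.Icc 0 s, ∀ i, |z u i| < kb i) →
      ∀ i, c i ≤ kb i ^ 2 - z s i ^ 2) :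
    ∀ t, 0 ≤ t → ∀ i, |z t i| < kb i := by
  by_contra! hcon
  obtain ⟨t, ht, hbad⟩ := hcon
  have hzi : ∀ i, Continuous fun s => z s i := fun i => (continuous_apply i).comp hz
  let S : Set ℝ := Set.Ici 0 ∩ ⋃ i, {s | kb i ≤ |z s i|}
  have hS : IsClosed S := isClosed_Ici.inter
    (isClosed_iUnion_of_finite fun i => isClosed_le continuous_const (hzi i).abs)
  have hbdd : BddBelow S := ⟨0, fun s hs => hs.1⟩
  obtain ⟨hT0, hT⟩ : sInf S ∈ S := hS.csInf_mem ⟨t, ht, Set.mem_iUnion.2 hbad⟩ hbdd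
  obtain ⟨i, hi⟩ := Set.mem_iUnion.1 hT
  have hlt : ∀ s, 0 ≤ s → s < sInf S → ∀ j, |z s j| < kb j := by
    intro s hs hsT j
    by_contra! h
    exact absurd (csInf_le hbdd ⟨hs, Set.mem_iUnion.2 ⟨j, h⟩⟩) (not_le.2 hsT)
  have hpos : 0 < sInf S := by
    refine lt_of_le_of_ne hT0 fun h => ?_
    rw [← h] at hi
    exact absurd (h0 i) (not_lt.2 hi)
  have hlim : Tendsto (fun s => kb i ^ 2 - z s i ^ 2) (𝓝[<] sInf S)
      (𝓝 (kb i ^ 2 - z (sInf S) i ^ 2)) :=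
    ((continuous_const.sub ((hzi i).pow 2)).tendsto _).mono_left nhdsWithin_le_nhds
  have hev : ∀ᶠ s in 𝓝[<] sInf S, c i ≤ kb i ^ 2 - z s i ^ 2 := by
    filter_upwards [Ioo_mem_nhdsLT hpos] with s hs
    exact hbar s hs.1.le (fun u hu => hlt u hu.1 (hu.2.trans_lt hs.2)) i
  have hge := ge_of_tendsto hlim hev
  have hsq : kb i ^ 2 ≤ z (sInf S) i ^ 2 := by
    rw [← sq_abs (z _ i)]
    exact pow_le_pow_left₀ (hkb i).le hi 2
  linarith [hc i]

/-- Twice the symmetric barrier Lyapunov function. -/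
noncomputable def barrierLyapunov {ι : Type*} [Fintype ι] (kb x y : ι → ℝ) : ℝ :=
  ∑ i, (Real.log (kb i ^ 2) - Real.log (kb i ^ 2 - x i ^ 2)) + ∑ i, y i ^ 2

theorem sq_sub_sq_pos_of_abs_lt {a b : ℝ} (h : |a| < b) : 0 < b ^ 2 - a ^ 2 := by
  have := sq_lt_sq' (abs_lt.1 h).1 (abs_lt.1 h).2
  linarith

/-- A bound on the barrier Lyapunov function bounds the distance to the faces of the box. -/
theorem mul_exp_neg_le_of_barrierLyapunov_le {ι : Type*} [Fintype ι] {kb x y : ι → ℝ} {C : ℝ}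
    (hx : ∀ i, |x i| < kb i) (hC : barrierLyapunov kb x y ≤ C) (i : ι) :
    kb i ^ 2 * Real.exp (-C) ≤ kb i ^ 2 - x i ^ 2 := by
  have hpos := fun j => sq_sub_sq_pos_of_abs_lt (hx j)
  have hkb : 0 < kb i ^ 2 := by nlinarith [hpos i, sq_nonneg (x i)]
  have hterm : ∀ j ∈ Finset.univ,
      0 ≤ Real.log (kb j ^ 2) - Real.log (kb j ^ 2 - x j ^ 2) := fun j _ =>
    sub_nonneg.2 (Real.log_le_log (hpos j) (by linarith [sq_nonneg (x j)]))
  have hsingle := Finset.single_le_sum hterm (Finset.mem_univ i)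
  have hy : 0 ≤ ∑ j, y j ^ 2 := Finset.sum_nonneg fun j _ => sq_nonneg (y j)
  have hlog : Real.log (kb i ^ 2) + -C ≤ Real.log (kb i ^ 2 - x i ^ 2) := by
    unfold barrierLyapunov at hC
    linarith
  calc kb i ^ 2 * Real.exp (-C) = Real.exp (Real.log (kb i ^ 2) + -C) := by
        rw [Real.exp_add, Real.exp_log hkb]
    _ ≤ Real.exp (Real.log (kb i ^ 2 - x i ^ 2)) := Real.exp_le_exp.2 hlog
    _ = _ := Real.exp_log (hpos i)

theorem hasDerivAt_barrierLyapunov {ι : Type*} [Fintype ι] {kb x' y' : ι → ℝ}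
    {x y : ℝ → ι → ℝ} {t : ℝ} (hx : ∀ i, |x t i| < kb i)
    (hx' : HasDerivAt x x' t) (hy' : HasDerivAt y y' t) :
    HasDerivAt (fun s => barrierLyapunov kb (x s) (y s))
      (∑ i, 2 * (x t i * x' i / (kb i ^ 2 - x t i ^ 2)) + ∑ i, 2 * (y t i * y' i)) t := by
  rw [hasDerivAt_pi] at hx' hy'
  refine (HasDerivAt.fun_sum fun i _ => ?_).add (HasDerivAt.fun_sum fun i _ => ?_)
  · have hne := (sq_sub_sq_pos_of_abs_lt (hx i)).ne'
    convert ((((hx' i).fun_pow 2).const_sub (kb i ^ 2)).log hne).const_sub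
      (Real.log (kb i ^ 2)) using 1
    field_simp
    simp
    ring
  · refine ((hy' i).fun_pow 2).congr_deriv ?_
    push_cast
    ring

/-- Along the closed-loop error dynamics the barrier Lyapunov function has derivative
`-2 (x ⬝ᵥ K₁ x) - 2 (y ⬝ᵥ K₂ y)`. -/
theorem hasDerivAt_barrierLyapunov_closedLoop {ι : Type*} [Fintype ι] [DecidableEq ι]
    {kb : ι → ℝ} {K₁ K₂ D : Matrix ι ι ℝ} {x y : ℝ → ι → ℝ} {t : ℝ}
    (hx : ∀ i, |x t i| < kb i)
    (hD : D = Matrix.diagonal fun i => 1 / (kb i ^ 2 - x t i ^ 2))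
    (hx' : HasDerivAt x (y t - D⁻¹.mulVec (K₁.mulVec (x t))) t)
    (hy' : HasDerivAt y (-(K₂.mulVec (y t)) - D.mulVec (x t)) t) :
    HasDerivAt (fun s => barrierLyapunov kb (x s) (y s))
      (-2 * (x t ⬝ᵥ K₁.mulVec (x t)) - 2 * (y t ⬝ᵥ K₂.mulVec (y t))) t := by
  have hne := fun i => (sq_sub_sq_pos_of_abs_lt (hx i)).ne'
  have hinv : D⁻¹ = Matrix.diagonal fun i => kb i ^ 2 - x t i ^ 2 := by
    refine Matrix.inv_eq_right_inv ?_
    rw [hD, Matrix.diagonal_mul_diagonal, ← Matrix.diagonal_one]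
    congr 1
    funext i
    exact one_div_mul_cancel (hne i)
  convert hasDerivAt_barrierLyapunov hx hx' hy' using 1
  rw [hinv, hD]
  simp only [dotProduct, Finset.mul_sum, ← Finset.sum_add_distrib, ← Finset.sum_sub_distrib,
    Pi.sub_apply, Pi.neg_apply, Matrix.mulVec_diagonal]
  refine Finset.sum_congr rfl fun i _ => ?_
  have := hne i
  field_simp
  ring


/-- symmetric BLF closed-loop constraint invariance for an n-DoF
Euler–Lagrange system. -/
theorem stmt_0 (n : ℕ) (hn : 1 ≤ n) (kb : Fin n → ℝ) (hkb : ∀ i, 0 < kb i)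
    (K₁ K₂ : Matrix (Fin n) (Fin n) ℝ) (hK₁ : K₁.PosDef) (hK₂ : K₂.PosDef)
    (z₁ z₂ : ℝ → (Fin n → ℝ))
    (hz₁ : Differentiable ℝ z₁) (hz₂ : Differentiable ℝ z₂)
    (D₁ : ℝ → Matrix (Fin n) (Fin n) ℝ)
    (hD₁ : ∀ t, D₁ t = Matrix.diagonal fun i => 1 / (kb i ^ 2 - z₁ t i ^ 2))
    (heq₁ : ∀ t, 0 ≤ t →
      deriv z₁ t = z₂ t - (D₁ t)⁻¹.mulVec (K₁.mulVec (z₁ t)))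
    (heq₂ : ∀ t, 0 ≤ t →
      deriv z₂ t = -(K₂.mulVec (z₂ t)) - (D₁ t).mulVec (z₁ t))
    (h0 : ∀ i, |z₁ 0 i| < kb i) :
    ∀ t, 0 ≤ t → ∀ i, |z₁ t i| < kb i := by
  refine forall_abs_lt_of_barrier kb hkb z₁ hz₁.continuous h0
    (fun i => kb i ^ 2 * Real.exp (-barrierLyapunov kb (z₁ 0) (z₂ 0)))
    (fun i => mul_pos (pow_pos (hkb i) 2) (Real.exp_pos _)) fun s hs hin => ?_
  refine mul_exp_neg_le_of_barrierLyapunov_le (y := z₂ s) (hin s ⟨hs, le_rfl⟩) ?_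
  have hderiv : ∀ u ∈ Set.Icc 0 s, HasDerivAt (fun s => barrierLyapunov kb (z₁ s) (z₂ s))
      (-2 * (z₁ u ⬝ᵥ K₁.mulVec (z₁ u)) - 2 * (z₂ u ⬝ᵥ K₂.mulVec (z₂ u))) u := fun u hu =>
    hasDerivAt_barrierLyapunov_closedLoop (hin u hu) (hD₁ u)
      (heq₁ u hu.1 ▸ (hz₁ u).hasDerivAt) (heq₂ u hu.1 ▸ (hz₂ u).hasDerivAt)
  have hanti : AntitoneOn (fun s => barrierLyapunov kb (z₁ s) (z₂ s)) (Set.Icc 0 s) := by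
    refine antitoneOn_of_deriv_nonpos (convex_Icc 0 s)
      (fun u hu => (hderiv u hu).continuousAt.continuousWithinAt)
      (fun u hu => (hderiv u (interior_subset hu)).differentiableAt.differentiableWithinAt)
      fun u hu => ?_
    rw [(hderiv u (interior_subset hu)).deriv]
    have h₁ := hK₁.posSemidef.dotProduct_mulVec_nonneg (z₁ u)
    have h₂ := hK₂.posSemidef.dotProduct_mulVec_nonneg (z₂ u)
    rw [star_trivial] at h₁ h₂
    linarith
  exact hanti ⟨le_rfl, hs⟩ ⟨hs, le_rfl⟩ hs
end

section
/- Let n ≥ 1, let k_a, k_b ∈ ℝⁿ have all entries positive, and let K₁, K₂ be positive definite real n×n matrices. Let z₁, z₂ : ℝ → ℝⁿ be differentiable functions such that for all t ≥ 0: ż₁(t) = z₂(t) − D₂(t)⁻¹ K₁ z₁(t) and ż₂(t) = −K₂ z₂(t) − D₂(t) z₁(t), where D₂(t) is the diagonal matrix with i-th diagonal entry rᵢ(t)/(k_{b,i}² − z₁ᵢ(t)²) + (1 − rᵢ(t))/(k_{a,i}² − z₁ᵢ(t)²) and rᵢ(t) = 1 if z₁ᵢ(t) > 0 and rᵢ(t)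 = 0 if z₁ᵢ(t) ≤ 0. If −k_{a,i} < z₁ᵢ(0) < k_{b,i} for every i, then −k_{a,i} < z₁ᵢ(t) < k_{b,i} for every i and all t ≥ 0. -/
open Real Set Topology

/-- The asymmetric logarithmic barrier on `(-a, b)`. -/
noncomputable def asymBarrier (a b x : ℝ) : ℝ :=
  if 0 < x then 1 / 2 * log (b ^ 2 / (b ^ 2 - x ^ 2)) else 1 / 2 * log (a ^ 2 / (a ^ 2 - x ^ 2))

lemma hasDerivAt_half_log_div_sq_sub_sq {b x : ℝ} (hb : 0 < b) (hx : 0 < b ^ 2 - x ^ 2) :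
    HasDerivAt (fun y => 1 / 2 * log (b ^ 2 / (b ^ 2 - y ^ 2))) (x / (b ^ 2 - x ^ 2)) x := by
  have h₁ : HasDerivAt (fun y : ℝ => b ^ 2 - y ^ 2) (-(2 * x)) x := by
    simpa using (hasDerivAt_pow 2 x).const_sub (b ^ 2)
  have h₂ := (((hasDerivAt_const x (b ^ 2)).div h₁ hx.ne').log
    (div_pos (pow_pos hb 2) hx).ne').const_mul (1 / 2)
  refine h₂.congr_deriv ?_
  simp only [Pi.div_apply]
  field_simp
  ring

lemma asymBarrier_nonneg {a b x : ℝ} (ha : 0 < a) (hb : 0 < b) (hxa : -a < x) (hxb : x < b) :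
    0 ≤ asymBarrier a b x := by
  unfold asymBarrier
  split_ifs with h
  · have hx : 0 < b ^ 2 - x ^ 2 := by nlinarith
    have : 1 ≤ b ^ 2 / (b ^ 2 - x ^ 2) := by
      rw [le_div_iff₀ hx]; nlinarith
    have := log_nonneg this
    positivity
  · have hx : 0 < a ^ 2 - x ^ 2 := by nlinarith
    have : 1 ≤ a ^ 2 / (a ^ 2 - x ^ 2) := by
      rw [le_div_iff₀ hx]; nlinarith
    have := log_nonneg this
    positivity

lemma hasDerivAt_asymBarrier {a b x : ℝ} (ha : 0 < a) (hb : 0 < b) (hxa : -a < x) (hxb : x < b) :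
    HasDerivAt (asymBarrier a b)
      (if 0 < x then x / (b ^ 2 - x ^ 2) else x / (a ^ 2 - x ^ 2)) x := by
  rcases lt_trichotomy x 0 with h | rfl | h
  · rw [if_neg h.not_gt]
    refine (hasDerivAt_half_log_div_sq_sub_sq ha (by nlinarith)).congr_of_eventuallyEq ?_
    filter_upwards [Iio_mem_nhds h] with y hy
    exact if_neg (not_lt.2 (le_of_lt hy))
  · have hA : HasDerivWithinAt (asymBarrier a b) 0 (Iic 0) 0 := by
      have := hasDerivAt_half_log_div_sq_sub_sq (x := 0) ha (by nlinarith)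
      rw [zero_div] at this
      refine this.hasDerivWithinAt.congr (fun y hy => ?_) ?_
      · exact if_neg (not_lt.2 hy)
      · exact if_neg (lt_irrefl _)
    have hB : HasDerivWithinAt (asymBarrier a b) 0 (Ici 0) 0 := by
      have := hasDerivAt_half_log_div_sq_sub_sq (x := 0) hb (by nlinarith)
      rw [zero_div] at this
      have h0 : asymBarrier a b 0 = 1 / 2 * log (b ^ 2 / (b ^ 2 - 0 ^ 2)) := by
        simp [asymBarrier, div_self (pow_pos ha 2).ne', div_self (pow_pos hb 2).ne']
      refine this.hasDerivWithinAt.congr (fun y hy => ?_) h0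
      rcases eq_or_lt_of_le (mem_Ici.1 hy) with rfl | hy
      · exact h0
      · exact if_pos hy
    simpa [Iic_union_Ici] using hA.union hB
  · rw [if_pos h]
    refine (hasDerivAt_half_log_div_sq_sub_sq hb (by nlinarith)).congr_of_eventuallyEq ?_
    filter_upwards [Ioi_mem_nhds h] with y hy
    exact if_pos hy

lemma abs_le_of_half_log_div_le {b x C : ℝ} (hb : 0 < b) (hx : 0 < b ^ 2 - x ^ 2)
    (h : 1 / 2 * log (b ^ 2 / (b ^ 2 - x ^ 2)) ≤ C) : |x| ≤ b * √(1 - exp (-(2 * C))) := by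
  have h₁ : b ^ 2 / (b ^ 2 - x ^ 2) ≤ exp (2 * C) :=
    (log_le_iff_le_exp (div_pos (pow_pos hb 2) hx)).1 (by linarith)
  rw [div_le_iff₀ hx] at h₁
  have h₂ : exp (-(2 * C)) * exp (2 * C) = 1 := by rw [← exp_add]; simp
  have h₃ : x ^ 2 ≤ b ^ 2 * (1 - exp (-(2 * C))) := by
    have := mul_le_mul_of_nonneg_left h₁ (exp_pos (-(2 * C))).le
    rw [← mul_assoc, h₂] at this
    linarith
  calc |x| = √(x ^ 2) := (sqrt_sq_eq_abs x).symm
    _ ≤ √(b ^ 2 * (1 - exp (-(2 * C)))) := sqrt_le_sqrt h₃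
    _ = b * √(1 - exp (-(2 * C))) := by rw [sqrt_mul (sq_nonneg b), sqrt_sq hb.le]

/-- Sublevel sets of the barrier stay uniformly away from the end points of `(-a, b)`. -/
lemma mem_Icc_of_asymBarrier_le {a b x C : ℝ} (ha : 0 < a) (hb : 0 < b) (hxa : -a < x)
    (hxb : x < b) (h : asymBarrier a b x ≤ C) :
    x ∈ Icc (-(a * √(1 - exp (-(2 * C))))) (b * √(1 - exp (-(2 * C)))) := by
  have hq := sqrt_nonneg (1 - exp (-(2 * C)))
  have hqa := mul_nonneg ha.le hq
  have hqb := mul_nonneg hb.le hq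
  unfold asymBarrier at h
  split_ifs at h with hx
  · have := abs_le_of_half_log_div_le hb (by nlinarith) h
    exact ⟨by linarith, (le_abs_self x).trans this⟩
  · have := abs_le_of_half_log_div_le ha (by nlinarith) h
    exact ⟨(abs_le.1 this).1, by linarith⟩

open Matrix in
/-- The dissipation identity of the closed loop: the cross terms cancel. -/
lemma dotProduct_closedLoop_nonpos {n : ℕ} {K₁ K₂ D : Matrix (Fin n) (Fin n) ℝ}
    (hK₁ : K₁.PosDef) (hK₂ : K₂.PosDef) (hD : IsUnit D.det) (hDt : Dᵀ = D) (x y : Fin n → ℝ) :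
    (D *ᵥ x) ⬝ᵥ (y - D⁻¹ *ᵥ (K₁ *ᵥ x)) + y ⬝ᵥ (-(K₂ *ᵥ y) - D *ᵥ x) ≤ 0 := by
  have h₁ : (D *ᵥ x) ⬝ᵥ (D⁻¹ *ᵥ (K₁ *ᵥ x)) = x ⬝ᵥ (K₁ *ᵥ x) := by
    rw [dotProduct_mulVec, ← hDt, mulVec_transpose, vecMul_vecMul, hDt,
      mul_nonsing_inv D hD, vecMul_one]
  have h₂ : 0 ≤ x ⬝ᵥ (K₁ *ᵥ x) := by simpa using hK₁.posSemidef.dotProduct_mulVec_nonneg x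
  have h₃ : 0 ≤ y ⬝ᵥ (K₂ *ᵥ y) := by simpa using hK₂.posSemidef.dotProduct_mulVec_nonneg y
  rw [dotProduct_sub, dotProduct_sub, dotProduct_neg, h₁, dotProduct_comm y (D *ᵥ x)]
  linarith

/-- The first time at which a path leaves an open set. -/
lemma exists_first_exit {X : Type*} [TopologicalSpace X] {z : ℝ → X} (hz : Continuous z)
    {U : Set X} (hU : IsOpen U) (h0 : z 0 ∈ U) {t : ℝ} (ht : 0 ≤ t) (hzt : z t ∉ U) :
    ∃ T, 0 < T ∧ z T ∉ U ∧ ∀ s ∈ Ico 0 T, z s ∈ U := by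
  set B := Ici 0 ∩ z ⁻¹' Uᶜ
  have hB : IsClosed B := isClosed_Ici.inter (hU.isClosed_compl.preimage hz)
  have hbdd : BddBelow B := ⟨0, fun s hs => hs.1⟩
  obtain ⟨hT, hzT⟩ := hB.csInf_mem ⟨t, ht, hzt⟩ hbdd
  refine ⟨sInf B, lt_of_le_of_ne hT fun h => hzT (h ▸ h0), hzT, fun s hs => ?_⟩
  by_contra hsU
  exact (csInf_le hbdd ⟨hs.1, hsU⟩).not_gt hs.2

/-- asymmetric BLF closed-loop constraint invariance for an n-DoF
Euler–Lagrange system. -/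
theorem stmt_1 (n : ℕ) (hn : 1 ≤ n) (ka kb : Fin n → ℝ)
    (hka : ∀ i, 0 < ka i) (hkb : ∀ i, 0 < kb i)
    (K₁ K₂ : Matrix (Fin n) (Fin n) ℝ) (hK₁ : K₁.PosDef) (hK₂ : K₂.PosDef)
    (z₁ z₂ : ℝ → (Fin n → ℝ))
    (hz₁ : Differentiable ℝ z₁) (hz₂ : Differentiable ℝ z₂)
    (r : ℝ → Fin n → ℝ)
    (hr : ∀ t i, r t i = if 0 < z₁ t i then 1 else 0)
    (D₂ : ℝ → Matrix (Fin n) (Fin n) ℝ)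
    (hD₂ : ∀ t, D₂ t = Matrix.diagonal fun i =>
      r t i / (kb i ^ 2 - z₁ t i ^ 2) + (1 - r t i) / (ka i ^ 2 - z₁ t i ^ 2))
    (heq₁ : ∀ t, 0 ≤ t →
      deriv z₁ t = z₂ t - (D₂ t)⁻¹.mulVec (K₁.mulVec (z₁ t)))
    (heq₂ : ∀ t, 0 ≤ t →
      deriv z₂ t = -(K₂.mulVec (z₂ t)) - (D₂ t).mulVec (z₁ t))
    (h0 : ∀ i, -ka i < z₁ 0 i ∧ z₁ 0 i < kb i) :
    ∀ t, 0 ≤ t → ∀ i, -ka i < z₁ t i ∧ z₁ t i < kb i := by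
  intro t ht
  by_contra hcon
  set U : Set (Fin n → ℝ) := univ.pi fun i => Ioo (-ka i) (kb i) with hU
  have hUmem : ∀ x, x ∈ U ↔ ∀ i, -ka i < x i ∧ x i < kb i := fun x => by simp [hU]
  obtain ⟨T, hT, hzT, hin⟩ := exists_first_exit hz₁.continuous
    (isOpen_set_pi finite_univ fun i _ => isOpen_Ioo) ((hUmem _).2 h0) ht
    (fun h => hcon ((hUmem _).1 h))
  replace hin : ∀ s ∈ Ico 0 T, ∀ i, -ka i < z₁ s i ∧ z₁ s i < kb i :=
    fun s hs => (hUmem _).1 (hin s hs)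
  set V : ℝ → ℝ := fun s => ∑ i, asymBarrier (ka i) (kb i) (z₁ s i) + 1 / 2 * ∑ i, z₂ s i ^ 2
    with hV
  have hVd : ∀ s ∈ Ico 0 T,
      HasDerivAt V ((D₂ s).mulVec (z₁ s) ⬝ᵥ deriv z₁ s + z₂ s ⬝ᵥ deriv z₂ s) s := by
    intro s hs
    have hd₁ := hasDerivAt_pi.1 (hz₁ s).hasDerivAt
    have hd₂ := hasDerivAt_pi.1 (hz₂ s).hasDerivAt
    have hb := HasDerivAt.fun_sum (u := Finset.univ) fun i _ =>
      (hasDerivAt_asymBarrier (hka i) (hkb i) (hin s hs i).1 (hin s hs i).2).comp s (hd₁ i)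
    have hq := (HasDerivAt.fun_sum (u := Finset.univ) fun i _ => (hd₂ i).pow 2).const_mul (1 / 2)
    refine (hb.add hq).congr_deriv ?_
    rw [dotProduct, dotProduct, Finset.mul_sum]
    congr 1 <;> refine Finset.sum_congr rfl fun i _ => ?_
    · rw [hD₂, Matrix.mulVec_diagonal, hr]
      split_ifs <;> simp [div_eq_inv_mul]
    · push_cast
      ring
  have hVle : ∀ s ∈ Ico 0 T, deriv V s ≤ 0 := by
    intro s hs
    rw [(hVd s hs).deriv, heq₁ s hs.1, heq₂ s hs.1]
    refine dotProduct_closedLoop_nonpos hK₁ hK₂ ?_ ?_ _ _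
    · rw [hD₂, Matrix.det_diagonal, isUnit_iff_ne_zero, Finset.prod_ne_zero_iff]
      intro i _
      obtain ⟨h₁, h₂⟩ := hin s hs i
      rw [hr]
      split_ifs with h
      · have : 0 < kb i ^ 2 - z₁ s i ^ 2 := by nlinarith
        simpa using this.ne'
      · have : 0 < ka i ^ 2 - z₁ s i ^ 2 := by nlinarith
        simpa using this.ne'
    · rw [hD₂, Matrix.diagonal_transpose]
  have hanti : AntitoneOn V (Ico 0 T) :=
    antitoneOn_of_deriv_nonpos (convex_Ico 0 T)
      (fun s hs => (hVd s hs).continuousAt.continuousWithinAt)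
      (fun s hs => (hVd s (interior_subset hs)).differentiableAt.differentiableWithinAt)
      (fun s hs => hVle s (interior_subset hs))
  have hq : √(1 - exp (-(2 * V 0))) < 1 := by
    rw [sqrt_lt' one_pos]
    linarith [exp_pos (-(2 * V 0))]
  refine hzT ((hUmem _).2 fun i => ?_)
  have hmem : ∀ s ∈ Ico 0 T, z₁ s i ∈
      Icc (-(ka i * √(1 - exp (-(2 * V 0))))) (kb i * √(1 - exp (-(2 * V 0)))) := by
    intro s hs
    refine mem_Icc_of_asymBarrier_le (hka i) (hkb i) (hin s hs i).1 (hin s hs i).2 ?_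
    have h₁ := hanti (left_mem_Ico.2 hT) hs hs.1
    have h₂ := Finset.single_le_sum (f := fun j => asymBarrier (ka j) (kb j) (z₁ s j))
      (fun j _ => asymBarrier_nonneg (hka j) (hkb j) (hin s hs j).1 (hin s hs j).2)
      (Finset.mem_univ i)
    have h₃ : 0 ≤ ∑ j, z₂ s j ^ 2 := Finset.sum_nonneg fun j _ => sq_nonneg _
    simp only [hV] at h₁ h₂ ⊢
    linarith
  have hcont : Continuous fun s => z₁ s i := (continuous_apply i).comp hz₁.continuous
  have hTmem : T ∈ closure (Ico 0 T) := by
    rw [closure_Ico hT.ne]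
    exact right_mem_Icc.2 hT.le
  obtain ⟨hl, hu⟩ := closure_minimal (t := (fun s => z₁ s i) ⁻¹' Icc _ _) hmem
    (isClosed_Icc.preimage hcont) hTmem
  exact ⟨by nlinarith [hka i], by nlinarith [hkb i]⟩
end

section
/- Let k > 0 and B ≥ 0 be real numbers and let z : ℝ → ℝ be continuous with |z(0)| < k. Suppose that for every t ≥ 0, if |z(s)| < k for all s ∈ [0, t], then (1/2)·log(k²/(k² − z(t)²)) ≤ B. Then |z(t)| < k for all t ≥ 0, and moreover |z(t)| ≤ k·√(1 − e^{−2B}) for all t ≥ 0. -/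
/-- A bound on the symmetric barrier term confines its argument to a smaller ball. -/
theorem abs_le_of_barrier_le {k B x : ℝ} (hk : 0 < k) (hx : |x| < k)
    (h : (1 / 2) * Real.log (k ^ 2 / (k ^ 2 - x ^ 2)) ≤ B) :
    |x| ≤ k * Real.sqrt (1 - Real.exp (-2 * B)) := by
  have hpos : 0 < k ^ 2 - x ^ 2 := sub_pos.2 (sq_lt_sq' (abs_lt.1 hx).1 (abs_lt.1 hx).2)
  have hle : k ^ 2 / (k ^ 2 - x ^ 2) ≤ Real.exp (2 * B) :=
    (Real.log_le_iff_le_exp (by positivity)).1 (by linarith)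
  rw [div_le_iff₀ hpos] at hle
  have hexp : Real.exp (-2 * B) * Real.exp (2 * B) = 1 := by
    rw [← Real.exp_add]
    simp
  have hmul : Real.exp (-2 * B) * k ^ 2 ≤ k ^ 2 - x ^ 2 := by
    calc Real.exp (-2 * B) * k ^ 2
        ≤ Real.exp (-2 * B) * (Real.exp (2 * B) * (k ^ 2 - x ^ 2)) := by gcongr
      _ = k ^ 2 - x ^ 2 := by rw [← mul_assoc, hexp, one_mul]
  calc |x| = Real.sqrt (x ^ 2) := (Real.sqrt_sq_eq_abs x).symm
    _ ≤ Real.sqrt (k ^ 2 * (1 - Real.exp (-2 * B))) := Real.sqrt_le_sqrt (by linarith)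
    _ = k * Real.sqrt (1 - Real.exp (-2 * B)) := by
      rw [Real.sqrt_mul (sq_nonneg k), Real.sqrt_sq hk.le]

/-- A continuous function that starts below `k`, and stays below some `c < k` for as long as it
has stayed below `k`, stays below `k` forever. -/
theorem lt_of_forall_lt_imp_le {f : ℝ → ℝ} {c k : ℝ} (hf : Continuous f) (hck : c < k)
    (h0 : f 0 < k)
    (hstep : ∀ t, 0 ≤ t → (∀ s ∈ Set.Icc 0 t, f s < k) → f t ≤ c) {t : ℝ} (ht : 0 ≤ t) :
    f t < k := by
  by_contra! hkt
  let S : Set ℝ := Set.Ici 0 ∩ {s | k ≤ f s}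
  have hbdd : BddBelow S := ⟨0, fun s hs => hs.1⟩
  have hmem : sInf S ∈ S :=
    (isClosed_Ici.inter (isClosed_le continuous_const hf)).csInf_mem ⟨t, ht, hkt⟩ hbdd
  obtain ⟨hT, hkT⟩ : 0 ≤ sInf S ∧ k ≤ f (sInf S) := hmem
  have hbefore : ∀ s, 0 ≤ s → s < sInf S → f s < k := fun s hs hsT => by
    by_contra! hks
    exact notMem_of_lt_csInf hsT hbdd ⟨hs, hks⟩
  have hne : (0 : ℝ) ≠ sInf S := fun h => absurd (h ▸ hkT) h0.not_ge
  have hle : ∀ s ∈ Set.Ico 0 (sInf S), f s ≤ c := fun s hs =>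
    hstep s hs.1 fun r hr => hbefore r hr.1 (hr.2.trans_lt hs.2)
  have hcl : sInf S ∈ closure (Set.Ico 0 (sInf S)) := by
    rw [closure_Ico hne]
    exact Set.right_mem_Icc.2 hT
  have hTc : f (sInf S) ≤ c :=
    le_on_closure hle hf.continuousOn continuousOn_const hcl
  linarith


/-- constraint-invariance principle: a continuous trajectory starting
strictly inside the constraint set whose barrier value is uniformly bounded (as long
as the constraint holds) never reaches the constraint boundary. -/
theorem stmt_7 (k B : ℝ) (hk : 0 < k) (hB : 0 ≤ B) (z : ℝ → ℝ) (hz : Continuous z)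
    (h0 : |z 0| < k)
    (hbound : ∀ t, 0 ≤ t → (∀ s ∈ Set.Icc 0 t, |z s| < k) →
      (1 / 2) * Real.log (k ^ 2 / (k ^ 2 - z t ^ 2)) ≤ B) :
    ∀ t, 0 ≤ t → |z t| < k ∧ |z t| ≤ k * Real.sqrt (1 - Real.exp (-2 * B)) := by
  have hck : k * Real.sqrt (1 - Real.exp (-2 * B)) < k := by
    have hsqrt : Real.sqrt (1 - Real.exp (-2 * B)) < 1 := by
      rw [Real.sqrt_lt' one_pos]
      linarith [Real.exp_pos (-2 * B)]
    exact mul_lt_of_lt_one_right hk hsqrt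
  have hstep : ∀ t, 0 ≤ t → (∀ s ∈ Set.Icc 0 t, |z s| < k) →
      |z t| ≤ k * Real.sqrt (1 - Real.exp (-2 * B)) := fun t ht h =>
    abs_le_of_barrier_le hk (h t (Set.right_mem_Icc.2 ht)) (hbound t ht h)
  have hlt : ∀ t, 0 ≤ t → |z t| < k := fun t ht =>
    lt_of_forall_lt_imp_le hz.abs hck h0 hstep ht
  exact fun t ht => ⟨hlt t ht, hstep t ht fun s hs => hlt s hs.1⟩
end
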